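/- arXiv:2311.11078 — 4 statements merged into one kernel-verified Lean document; each statement's English description precedes it below -/
import Mathlib

section
/- One has ⁅f₋₁, e₀⁆ = 0 and ⁅e₋₁, f₀⁆ = 0, and for every ℓ with 1 ≤ ℓ ≤ j-1 one has ⁅f₋₁, e_ℓ⁆ = (j-ℓ)•e_{ℓ-1} and ⁅e₋₁, f_ℓ⁆ = (j-ℓ)•f_{ℓ-1}. (Identities (L:4b) and (L:4d) of Theorem 2.8 of the paper.) -/
open LieAlgebra in
/-- If `x` has weight `2` and `v` has weight `c` for `h`, then `(ad x) ^ n v` has weight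
`c + 2 * n`. -/
theorem lie_ad_pow_of_weight {L : Type*} [LieRing L] [LieAlgebra ℂ L] {h x v : L} {c : ℂ}
    (hx : ⁅h, x⁆ = (2 : ℂ) • x) (hv : ⁅h, v⁆ = c • v) (n : ℕ) :
    ⁅h, (ad ℂ L x ^ n) v⁆ = (c + 2 * n) • (ad ℂ L x ^ n) v := by
  induction n with
  | zero => simp [hv]
  | succ n ih =>
    rw [pow_succ', Module.End.mul_apply, ad_apply, leibniz_lie, hx, ih, smul_lie, lie_smul]
    push_cast
    module

open LieAlgebra in
/-- The lowering operator on the string through a lowest weight vector. -/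
theorem lie_ad_pow_succ_of_lie_eq_zero {L : Type*} [LieRing L] [LieAlgebra ℂ L]
    {h x y v : L} {c : ℂ} (hxy : ⁅x, y⁆ = h) (hx : ⁅h, x⁆ = (2 : ℂ) • x)
    (hv : ⁅h, v⁆ = c • v) (hy : ⁅y, v⁆ = 0) (n : ℕ) :
    ⁅y, (ad ℂ L x ^ (n + 1)) v⁆ = (-(n + 1) * (c + n)) • (ad ℂ L x ^ n) v := by
  have hyx : ⁅y, x⁆ = -h := by rw [← lie_skew, hxy]
  induction n with
  | zero => simp [leibniz_lie y x v, hyx, hv, hy]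
  | succ n ih =>
    rw [pow_succ', Module.End.mul_apply, ad_apply, leibniz_lie, ih, hyx, neg_lie,
      lie_ad_pow_of_weight hx hv, lie_smul, ← ad_apply ℂ L x, ← Module.End.mul_apply,
      ← pow_succ']
    push_cast
    module

open LieAlgebra in
/-- The lowering operator on divided powers applied to a vector of weight `1 - j`. -/
theorem lie_divided_ad_pow {L : Type*} [LieRing L] [LieAlgebra ℂ L]
    {h x y v : L} {j : ℂ} (hxy : ⁅x, y⁆ = h) (hx : ⁅h, x⁆ = (2 : ℂ) • x)
    (hv : ⁅h, v⁆ = (1 - j) • v) (hy : ⁅y, v⁆ = 0) {n : ℕ} (hn : 1 ≤ n) :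
    ⁅y, (n.factorial : ℂ)⁻¹ • (ad ℂ L x ^ n) v⁆ =
      (j - n) • ((n - 1).factorial : ℂ)⁻¹ • (ad ℂ L x ^ (n - 1)) v := by
  obtain ⟨k, rfl⟩ := Nat.exists_eq_add_of_le' hn
  have hk : (k.factorial : ℂ) ≠ 0 := Nat.cast_ne_zero.mpr k.factorial_ne_zero
  have hk' : (k : ℂ) + 1 ≠ 0 := Nat.cast_add_one_ne_zero k
  rw [lie_smul, lie_ad_pow_succ_of_lie_eq_zero hxy hx hv hy, smul_smul, Nat.add_sub_cancel,
    smul_smul, Nat.factorial_succ]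
  congr 1
  push_cast
  field_simp
  ring

theorem monster_L4b_L4d {L : Type*} [LieRing L] [LieAlgebra ℂ L]
    (j : ℕ) (hj : 1 ≤ j)
    (eneg fneg h₁ h₂ e f : L)
    (rel_hh : ⁅h₁, h₂⁆ = 0)
    (rel_h1eneg : ⁅h₁, eneg⁆ = eneg) (rel_h2eneg : ⁅h₂, eneg⁆ = -eneg)
    (rel_h1fneg : ⁅h₁, fneg⁆ = -fneg) (rel_h2fneg : ⁅h₂, fneg⁆ = fneg)
    (rel_h1e : ⁅h₁, e⁆ = e) (rel_h2e : ⁅h₂, e⁆ = (j : ℂ) • e)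
    (rel_h1f : ⁅h₁, f⁆ = -f) (rel_h2f : ⁅h₂, f⁆ = -((j : ℂ) • f))
    (rel_enegfneg : ⁅eneg, fneg⁆ = h₁ - h₂)
    (rel_enegf : ⁅eneg, f⁆ = 0) (rel_efneg : ⁅e, fneg⁆ = 0)
    (rel_ef : ⁅e, f⁆ = -((j : ℂ) • h₁ + h₂))
    (rel_serre_e : (LieAlgebra.ad ℂ L eneg ^ j) e = 0)
    (rel_serre_f : (LieAlgebra.ad ℂ L fneg ^ j) f = 0)
    (eV fV : ℕ → L)
    (heV : ∀ ℓ : ℕ, eV ℓ = ((ℓ.factorial : ℂ))⁻¹ • (LieAlgebra.ad ℂ L eneg ^ ℓ) e)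
    (hfV : ∀ ℓ : ℕ, fV ℓ = ((ℓ.factorial : ℂ))⁻¹ • (LieAlgebra.ad ℂ L fneg ^ ℓ) f) :
    ⁅fneg, eV 0⁆ = 0 ∧ ⁅eneg, fV 0⁆ = 0 ∧
    ∀ ℓ : ℕ, 1 ≤ ℓ → ℓ ≤ j - 1 →
      ⁅fneg, eV ℓ⁆ = ((j : ℂ) - (ℓ : ℂ)) • eV (ℓ - 1) ∧
      ⁅eneg, fV ℓ⁆ = ((j : ℂ) - (ℓ : ℂ)) • fV (ℓ - 1) := by
  have hfe : ⁅fneg, e⁆ = 0 := by rw [← lie_skew, rel_efneg, neg_zero]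
  refine ⟨by simp [heV, hfe], by simp [hfV, rel_enegf], fun ℓ hℓ _ => ⟨?_, ?_⟩⟩
  · rw [heV, heV]
    refine lie_divided_ad_pow rel_enegfneg ?_ ?_ hfe hℓ
    · rw [sub_lie, rel_h1eneg, rel_h2eneg]
      module
    · rw [sub_lie, rel_h1e, rel_h2e]
      module
  · rw [hfV, hfV]
    have hfn : ⁅fneg, eneg⁆ = h₂ - h₁ := by rw [← lie_skew, rel_enegfneg, neg_sub]
    refine lie_divided_ad_pow hfn ?_ ?_ rel_enegf hℓ
    · rw [sub_lie, rel_h1fneg, rel_h2fneg]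
      module
    · rw [sub_lie, rel_h1f, rel_h2f]
      module
end

section
/- For every ℓ with 1 ≤ ℓ ≤ j-1 one has ⁅e_ℓ, f_{ℓ-1}⁆ = (-1)^{ℓ+1} • C(j-1, ℓ) • ℓ • e₋₁ and ⁅e_{ℓ-1}, f_ℓ⁆ = (-1)^{ℓ} • C(j-1, ℓ) • ℓ • f₋₁, where C(j-1,ℓ) is the binomial coefficient. (Identities (L:3a) and (L:3b) of Theorem 2.8 of the paper.) -/
section SlTwoStrings

variable {L : Type*} [LieRing L] [LieAlgebra ℂ L]

theorem ad_pow_succ_apply (x v : L) (k : ℕ) :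
    (LieAlgebra.ad ℂ L x ^ (k + 1)) v = ⁅x, (LieAlgebra.ad ℂ L x ^ k) v⁆ := by
  rw [pow_succ', Module.End.mul_apply, LieAlgebra.ad_apply]

/-- The weights of a string of vectors raised by `x`. -/
theorem lie_weight_ad_pow {h x v : L} {μ : ℂ} (hx : ⁅h, x⁆ = (2 : ℂ) • x)
    (hv : ⁅h, v⁆ = μ • v) (k : ℕ) :
    ⁅h, (LieAlgebra.ad ℂ L x ^ k) v⁆ = (μ + 2 * k) • (LieAlgebra.ad ℂ L x ^ k) v := by
  induction k with
  | zero => simpa using hv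
  | succ k ih =>
    rw [ad_pow_succ_apply, leibniz_lie, hx, ih, smul_lie, lie_smul]
    push_cast
    module

/-- The lowering operator on a string of vectors raised from a lowest weight vector. -/
theorem lie_lowering_ad_pow_succ {h x y v : L} {μ : ℂ} (hxy : ⁅x, y⁆ = h)
    (hx : ⁅h, x⁆ = (2 : ℂ) • x) (hv : ⁅h, v⁆ = -μ • v) (hy : ⁅y, v⁆ = 0) (k : ℕ) :
    ⁅y, (LieAlgebra.ad ℂ L x ^ (k + 1)) v⁆ =
      ((k + 1) * (μ - k)) • (LieAlgebra.ad ℂ L x ^ k) v := by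
  have hyx : ⁅y, x⁆ = -h := by rw [← lie_skew, hxy]
  induction k with
  | zero =>
    simp [leibniz_lie y x v, hyx, hy, hv]
  | succ k ih =>
    rw [ad_pow_succ_apply, leibniz_lie, hyx, ih, neg_lie, lie_weight_ad_pow hx hv, lie_smul,
      ← ad_pow_succ_apply]
    push_cast
    module

/-- Brackets between the string raised by `x` from `e` and the string raised by `y` from `f`,
with the scalars given by a solution `g` of a first order recurrence. -/
theorem lie_ad_pow_ad_pow {h x y e f : L} {μ : ℂ} (g : ℕ → ℂ) (g_zero : g 0 = 1)
    (g_succ : ∀ k : ℕ, g (k + 1) = -((k + 1) * (μ - k)) * g k)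
    (hxy : ⁅x, y⁆ = h) (hx : ⁅h, x⁆ = (2 : ℂ) • x) (hy : ⁅h, y⁆ = -((2 : ℂ) • y))
    (he : ⁅h, e⁆ = -μ • e) (hf : ⁅h, f⁆ = μ • f) (hye : ⁅y, e⁆ = 0) (hxf : ⁅x, f⁆ = 0)
    (hxef : ⁅x, ⁅e, f⁆⁆ = μ • x) (hyef : ⁅y, ⁅e, f⁆⁆ = -μ • y) (k : ℕ) :
    ⁅(LieAlgebra.ad ℂ L x ^ (k + 1)) e, (LieAlgebra.ad ℂ L y ^ k) f⁆ = -g (k + 1) • x ∧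
      ⁅(LieAlgebra.ad ℂ L x ^ k) e, (LieAlgebra.ad ℂ L y ^ (k + 1)) f⁆ = g (k + 1) • y := by
  have hyx : ⁅y, x⁆ = -h := by rw [← lie_skew, hxy]
  have hxh : ⁅x, h⁆ = -((2 : ℂ) • x) := by rw [← lie_skew, hx]
  have hyh : ⁅y, h⁆ = (2 : ℂ) • y := by rw [← lie_skew, hy, neg_neg]
  have low_e := lie_lowering_ad_pow_succ hxy hx he hye
  have low_f := lie_lowering_ad_pow_succ (h := -h) (μ := μ) hyx
    (by rw [neg_lie, hy, neg_neg]) (by rw [neg_lie, hf, neg_smul]) hxf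
  set A : ℕ → L := fun k => (LieAlgebra.ad ℂ L x ^ k) e with hA
  set B : ℕ → L := fun k => (LieAlgebra.ad ℂ L y ^ k) f with hB
  have A_succ (k : ℕ) : A (k + 1) = ⁅x, A k⁆ := ad_pow_succ_apply x e k
  have B_succ (k : ℕ) : B (k + 1) = ⁅y, B k⁆ := ad_pow_succ_apply y f k
  have lie_A_succ (k : ℕ) (w : L) : ⁅A (k + 1), w⁆ = ⁅x, ⁅A k, w⁆⁆ - ⁅A k, ⁅x, w⁆⁆ := by
    rw [A_succ, lie_lie]
  have lie_B_succ (k : ℕ) (w : L) : ⁅w, B (k + 1)⁆ = ⁅y, ⁅w, B k⁆⁆ - ⁅⁅y, w⁆, B k⁆ := by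
    rw [B_succ, leibniz_lie y w, add_sub_cancel_left]
  suffices H : ⁅x, ⁅A k, B k⁆⁆ = ((μ - 2 * k) * g k) • x ∧
      ⁅y, ⁅A k, B k⁆⁆ = -((μ - 2 * k) * g k) • y ∧
      ⁅A (k + 1), B k⁆ = -g (k + 1) • x ∧ ⁅A k, B (k + 1)⁆ = g (k + 1) • y from H.2.2
  induction k with
  | zero =>
    have A_zero : A 0 = e := by simp [hA]
    have B_zero : B 0 = f := by simp [hB]
    rw [lie_A_succ, lie_B_succ, A_zero, B_zero, hxf, hye, hxef, hyef, g_succ, g_zero]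
    simp
  | succ k ih =>
    obtain ⟨ihx, ihy, ihA, ihB⟩ := ih
    have hD : ⁅A (k + 1), B (k + 1)⁆ =
        g (k + 1) • h - ((k + 1) * (μ - k)) • ⁅A k, B k⁆ := by
      rw [lie_B_succ, ihA, low_e, lie_smul, hyx, smul_lie]
      module
    have hxD : ⁅x, ⁅A (k + 1), B (k + 1)⁆⁆ =
        ((μ - 2 * (k + 1 : ℕ)) * g (k + 1)) • x := by
      rw [hD, lie_sub, lie_smul, lie_smul, ihx, hxh, g_succ]
      push_cast
      module
    have hyD : ⁅y, ⁅A (k + 1), B (k + 1)⁆⁆ =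
        -((μ - 2 * (k + 1 : ℕ)) * g (k + 1)) • y := by
      rw [hD, lie_sub, lie_smul, lie_smul, ihy, hyh, g_succ]
      push_cast
      module
    refine ⟨hxD, hyD, ?_, ?_⟩
    · rw [lie_A_succ, hxD, low_f, lie_smul, ihA, g_succ (k + 1)]
      push_cast
      module
    · rw [lie_B_succ, hyD, low_e, smul_lie, ihB, g_succ (k + 1)]
      push_cast
      module

end SlTwoStrings

theorem cast_choose_succ_mul (n k : ℕ) :
    (n.choose (k + 1) : ℂ) * (k + 1) = n.choose k * (n - k) := by
  rcases le_or_gt k n with hk | hk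
  · have := Nat.choose_succ_right_eq n k
    rw [← Nat.cast_sub hk]
    exact_mod_cast this
  · simp [Nat.choose_eq_zero_of_lt hk, Nat.choose_eq_zero_of_lt (hk.trans k.lt_succ_self)]


theorem monster_L3a_L3b {L : Type*} [LieRing L] [LieAlgebra ℂ L]
    (j : ℕ) (hj : 1 ≤ j)
    (eneg fneg h₁ h₂ e f : L)
    (rel_hh : ⁅h₁, h₂⁆ = 0)
    (rel_h1eneg : ⁅h₁, eneg⁆ = eneg) (rel_h2eneg : ⁅h₂, eneg⁆ = -eneg)
    (rel_h1fneg : ⁅h₁, fneg⁆ = -fneg) (rel_h2fneg : ⁅h₂, fneg⁆ = fneg)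
    (rel_h1e : ⁅h₁, e⁆ = e) (rel_h2e : ⁅h₂, e⁆ = (j : ℂ) • e)
    (rel_h1f : ⁅h₁, f⁆ = -f) (rel_h2f : ⁅h₂, f⁆ = -((j : ℂ) • f))
    (rel_enegfneg : ⁅eneg, fneg⁆ = h₁ - h₂)
    (rel_enegf : ⁅eneg, f⁆ = 0) (rel_efneg : ⁅e, fneg⁆ = 0)
    (rel_ef : ⁅e, f⁆ = -((j : ℂ) • h₁ + h₂))
    (rel_serre_e : (LieAlgebra.ad ℂ L eneg ^ j) e = 0)
    (rel_serre_f : (LieAlgebra.ad ℂ L fneg ^ j) f = 0)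
    (eV fV : ℕ → L)
    (heV : ∀ ℓ : ℕ, eV ℓ = ((ℓ.factorial : ℂ))⁻¹ • (LieAlgebra.ad ℂ L eneg ^ ℓ) e)
    (hfV : ∀ ℓ : ℕ, fV ℓ = ((ℓ.factorial : ℂ))⁻¹ • (LieAlgebra.ad ℂ L fneg ^ ℓ) f) :
    ∀ ℓ : ℕ, 1 ≤ ℓ → ℓ ≤ j - 1 →
      ⁅eV ℓ, fV (ℓ - 1)⁆ = ((-1 : ℂ) ^ (ℓ + 1) * ((j - 1).choose ℓ : ℂ) * (ℓ : ℂ)) • eneg ∧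
      ⁅eV (ℓ - 1), fV ℓ⁆ = ((-1 : ℂ) ^ ℓ * ((j - 1).choose ℓ : ℂ) * (ℓ : ℂ)) • fneg := by
  obtain ⟨n, rfl⟩ : ∃ n, j = n + 1 := ⟨j - 1, by omega⟩
  intro ℓ hℓ _
  obtain ⟨k, rfl⟩ : ∃ k, ℓ = k + 1 := ⟨ℓ - 1, by omega⟩
  simp only [Nat.add_sub_cancel]
  have h1 (x c : L) (hc : ⁅h₁, x⁆ = c) : ⁅x, h₁⁆ = -c := by rw [← lie_skew, hc]
  have h2 (x c : L) (hc : ⁅h₂, x⁆ = c) : ⁅x, h₂⁆ = -c := by rw [← lie_skew, hc]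
  obtain ⟨hP, hQ⟩ := lie_ad_pow_ad_pow (h := h₁ - h₂) (x := eneg) (y := fneg) (e := e) (f := f)
    (μ := n) (fun k => (-1) ^ k * n.choose k * (k.factorial : ℂ) ^ 2) (by simp)
    (fun k => by
      have := cast_choose_succ_mul n k
      simp only [Nat.factorial_succ]
      push_cast
      linear_combination (-1) ^ (k + 1) * (k.factorial : ℂ) ^ 2 * (k + 1) * this)
    rel_enegfneg
    (by rw [sub_lie, rel_h1eneg, rel_h2eneg]; module)
    (by rw [sub_lie, rel_h1fneg, rel_h2fneg]; module)
    (by rw [sub_lie, rel_h1e, rel_h2e]; push_cast; module)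
    (by rw [sub_lie, rel_h1f, rel_h2f]; push_cast; module)
    (by rw [← lie_skew, rel_efneg, neg_zero]) rel_enegf
    (by
      rw [rel_ef, lie_neg, lie_add, lie_smul, h1 _ _ rel_h1eneg, h2 _ _ rel_h2eneg]
      push_cast
      module)
    (by
      rw [rel_ef, lie_neg, lie_add, lie_smul, h1 _ _ rel_h1fneg, h2 _ _ rel_h2fneg]
      push_cast
      module) k
  have hk : (k.factorial : ℂ) ≠ 0 := Nat.cast_ne_zero.2 k.factorial_ne_zero
  have hk1 : (k + 1 : ℂ) ≠ 0 := Nat.cast_add_one_ne_zero k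
  rw [heV, hfV, heV, hfV, smul_lie, lie_smul, hP, smul_lie, lie_smul, hQ]
  simp only [smul_smul, Nat.factorial_succ]
  push_cast
  constructor <;> congr 1 <;> field_simp <;> ring
end

section
/- For all ℓ, m with 0 ≤ ℓ, m ≤ j-1 and |ℓ - m| ≥ 2, one has ⁅e_ℓ, f_m⁆ = 0. (The same-block case of identity (L:1) of Theorem 2.8 of the paper.) -/
section

variable {L : Type*} [LieRing L] [LieAlgebra ℂ L]

theorem lie_ad_pow_of_lie_eq_smul {X H e : L} {a : ℂ}
    (hHX : ⁅H, X⁆ = (2 : ℂ) • X) (hHe : ⁅H, e⁆ = a • e) (n : ℕ) :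
    ⁅H, (LieAlgebra.ad ℂ L X ^ n) e⁆ = (a + 2 * n) • (LieAlgebra.ad ℂ L X ^ n) e := by
  induction n with
  | zero => simpa using hHe
  | succ n ih =>
    rw [pow_succ', Module.End.mul_apply, LieAlgebra.ad_apply, leibniz_lie, ih, hHX, smul_lie,
      lie_smul]
    push_cast
    module

theorem exists_lie_ad_pow_succ_eq_smul {X Y H e : L} {a : ℂ}
    (hXY : ⁅X, Y⁆ = H) (hHX : ⁅H, X⁆ = (2 : ℂ) • X) (hHe : ⁅H, e⁆ = a • e)
    (hYe : ⁅Y, e⁆ = 0) (n : ℕ) :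
    ∃ c : ℂ, ⁅Y, (LieAlgebra.ad ℂ L X ^ (n + 1)) e⁆ = c • (LieAlgebra.ad ℂ L X ^ n) e := by
  have hYX : ⁅Y, X⁆ = -H := by rw [← hXY, lie_skew]
  induction n with
  | zero => exact ⟨-a, by simp [leibniz_lie Y X e, hYX, hHe, hYe]⟩
  | succ n ih =>
    obtain ⟨c, hc⟩ := ih
    refine ⟨c - (a + 2 * (n + 1 : ℕ)), ?_⟩
    rw [pow_succ', Module.End.mul_apply, LieAlgebra.ad_apply, leibniz_lie, hYX, hc, neg_lie,
      lie_ad_pow_of_lie_eq_smul hHX hHe, lie_smul, ← LieAlgebra.ad_apply ℂ L X,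
      ← Module.End.mul_apply, ← pow_succ']
    module

theorem lie_ad_pow_ad_pow_eq_zero {X Y H e f : L} {a : ℂ}
    (hXY : ⁅X, Y⁆ = H) (hHX : ⁅H, X⁆ = (2 : ℂ) • X) (hHe : ⁅H, e⁆ = a • e)
    (hYe : ⁅Y, e⁆ = 0) (hXf : ⁅X, f⁆ = 0) (hXXef : ⁅X, ⁅X, ⁅e, f⁆⁆⁆ = 0)
    (m k : ℕ) :
    ⁅(LieAlgebra.ad ℂ L X ^ (m + 2 + k)) e, (LieAlgebra.ad ℂ L Y ^ m) f⁆ = 0 := by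
  induction m generalizing k with
  | zero =>
    have key (l : ℕ) : ⁅(LieAlgebra.ad ℂ L X ^ l) e, f⁆ = (LieAlgebra.ad ℂ L X ^ l) ⁅e, f⁆ := by
      induction l with
      | zero => simp
      | succ l ih =>
        rw [pow_succ', Module.End.mul_apply, Module.End.mul_apply, LieAlgebra.ad_apply,
          LieAlgebra.ad_apply, lie_lie, hXf, lie_zero, sub_zero, ih]
    have h2 : (LieAlgebra.ad ℂ L X ^ 2) ⁅e, f⁆ = 0 := by simpa [pow_two] using hXXef
    rw [pow_zero, Module.End.one_apply, key, zero_add, add_comm, pow_add, Module.End.mul_apply,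
      h2, map_zero]
  | succ m ih =>
    obtain ⟨c, hc⟩ := exists_lie_ad_pow_succ_eq_smul hXY hHX hHe hYe (m + 2 + k)
    rw [show m + 1 + 2 + k = m + 2 + k + 1 by ring, pow_succ' (LieAlgebra.ad ℂ L Y),
      Module.End.mul_apply, LieAlgebra.ad_apply, leibniz_lie, ← lie_skew _ Y, hc, neg_lie,
      smul_lie, ih k, show m + 2 + k + 1 = m + 2 + (k + 1) by ring, ih (k + 1)]
    simp

end

theorem monster_L1_same_block {L : Type*} [LieRing L] [LieAlgebra ℂ L]
    (j : ℕ) (hj : 1 ≤ j)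
    (eneg fneg h₁ h₂ e f : L)
    (rel_hh : ⁅h₁, h₂⁆ = 0)
    (rel_h1eneg : ⁅h₁, eneg⁆ = eneg) (rel_h2eneg : ⁅h₂, eneg⁆ = -eneg)
    (rel_h1fneg : ⁅h₁, fneg⁆ = -fneg) (rel_h2fneg : ⁅h₂, fneg⁆ = fneg)
    (rel_h1e : ⁅h₁, e⁆ = e) (rel_h2e : ⁅h₂, e⁆ = (j : ℂ) • e)
    (rel_h1f : ⁅h₁, f⁆ = -f) (rel_h2f : ⁅h₂, f⁆ = -((j : ℂ) • f))
    (rel_enegfneg : ⁅eneg, fneg⁆ = h₁ - h₂)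
    (rel_enegf : ⁅eneg, f⁆ = 0) (rel_efneg : ⁅e, fneg⁆ = 0)
    (rel_ef : ⁅e, f⁆ = -((j : ℂ) • h₁ + h₂))
    (rel_serre_e : (LieAlgebra.ad ℂ L eneg ^ j) e = 0)
    (rel_serre_f : (LieAlgebra.ad ℂ L fneg ^ j) f = 0)
    (eV fV : ℕ → L)
    (heV : ∀ ℓ : ℕ, eV ℓ = ((ℓ.factorial : ℂ))⁻¹ • (LieAlgebra.ad ℂ L eneg ^ ℓ) e)
    (hfV : ∀ ℓ : ℕ, fV ℓ = ((ℓ.factorial : ℂ))⁻¹ • (LieAlgebra.ad ℂ L fneg ^ ℓ) f) :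
    ∀ ℓ m : ℕ, ℓ ≤ j - 1 → m ≤ j - 1 → 2 ≤ |(ℓ : ℤ) - (m : ℤ)| →
      ⁅eV ℓ, fV m⁆ = 0 := by
  have hHX : ⁅h₁ - h₂, eneg⁆ = (2 : ℂ) • eneg := by
    rw [sub_lie, rel_h1eneg, rel_h2eneg]; module
  have hHY : ⁅-(h₁ - h₂), fneg⁆ = (2 : ℂ) • fneg := by
    rw [neg_lie, sub_lie, rel_h1fneg, rel_h2fneg]; module
  have hHe : ⁅h₁ - h₂, e⁆ = (1 - j : ℂ) • e := by
    rw [sub_lie, rel_h1e, rel_h2e]; module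
  have hHf : ⁅-(h₁ - h₂), f⁆ = (1 - j : ℂ) • f := by
    rw [neg_lie, sub_lie, rel_h1f, rel_h2f]; module
  have hYX : ⁅fneg, eneg⁆ = -(h₁ - h₂) := by rw [← rel_enegfneg, lie_skew]
  have hYe : ⁅fneg, e⁆ = 0 := by rw [← lie_skew, rel_efneg, neg_zero]
  have hX1 : ⁅eneg, h₁⁆ = -eneg := by rw [← lie_skew, rel_h1eneg]
  have hX2 : ⁅eneg, h₂⁆ = eneg := by rw [← lie_skew, rel_h2eneg, neg_neg]
  have hY1 : ⁅fneg, h₁⁆ = fneg := by rw [← lie_skew, rel_h1fneg, neg_neg]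
  have hY2 : ⁅fneg, h₂⁆ = -fneg := by rw [← lie_skew, rel_h2fneg]
  have hXXef : ⁅eneg, ⁅eneg, ⁅e, f⁆⁆⁆ = 0 := by simp [rel_ef, hX1, hX2]
  have hYYfe : ⁅fneg, ⁅fneg, ⁅f, e⁆⁆⁆ = 0 := by
    rw [← lie_skew f e, rel_ef]; simp [hY1, hY2]
  intro l m _ _ hlm
  rw [heV, hfV, smul_lie, lie_smul]
  rcases le_abs.mp hlm with h | h
  · obtain ⟨k, rfl⟩ : ∃ k, l = m + 2 + k := Nat.exists_eq_add_of_le (by omega)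
    rw [lie_ad_pow_ad_pow_eq_zero rel_enegfneg hHX hHe hYe rel_enegf hXXef, smul_zero, smul_zero]
  · obtain ⟨k, rfl⟩ : ∃ k, m = l + 2 + k := Nat.exists_eq_add_of_le (by omega)
    rw [← lie_skew, lie_ad_pow_ad_pow_eq_zero hYX hHY hHf rel_enegf hYe hYYfe, neg_zero,
      smul_zero, smul_zero]
end

section
/- Let j ≥ 1 be an integer and let ℓ, q be integers with 0 ≤ ℓ ≤ j-1 and 0 ≤ q ≤ j-1. Then Σ_{m=ℓ}^{j-1} Σ_{p=0}^{m} (-1)^{m-p} • C(m,ℓ) • C(j-1-p, m-p) • C(q,p) equals (-1)^ℓ if q = j-1-ℓ, and equals 0 otherwise. (The binomial identity established in the proof of Proposition 4.2 of the paper, computing the matrix entries of the Weyl element w̃₋₁.) -/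
open Finset in
theorem sum_neg_one_pow_mul_choose_sub_mul_choose (n q m : ℕ) (hq : q ≤ n) :
    ∑ p ∈ range (m + 1), (-1 : ℤ) ^ (m - p) * ((n - p).choose (m - p)) * (q.choose p) =
      (-1) ^ m * ((n - q).choose m) := by
  induction q generalizing n m with
  | zero => simp [sum_range_succ']
  | succ q ih =>
    obtain ⟨n, rfl⟩ : ∃ k, n = k + 1 := ⟨n - 1, by omega⟩
    cases m with
    | zero => simp
    | succ m =>
      have h₁ := ih (n + 1) (m + 1) (by omega)
      have h₂ := ih n m (by omega)
      rw [sum_range_succ'] at h₁ ⊢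
      rw [Nat.succ_sub (by omega : q ≤ n), Nat.choose_succ_succ] at h₁
      simp only [Nat.add_sub_add_right, Nat.choose_succ_succ q, Nat.cast_add, mul_add,
        sum_add_distrib, Nat.choose_zero_right] at h₁ h₂ ⊢
      rw [h₂]
      linear_combination h₁

open Finset in
theorem sum_Icc_neg_one_pow_mul_choose_mul_choose (n N ℓ : ℕ) (hN : N ≤ n) :
    ∑ m ∈ Icc ℓ n, (-1 : ℤ) ^ m * (N.choose m) * (m.choose ℓ) =
      if N = ℓ then (-1 : ℤ) ^ ℓ else 0 := by
  have h_trunc : ∑ m ∈ Icc ℓ n, (-1 : ℤ) ^ m * (N.choose m) * (m.choose ℓ) =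
      ∑ m ∈ Ico ℓ (N + 1), (-1 : ℤ) ^ m * (N.choose m) * (m.choose ℓ) := by
    symm
    apply sum_subset
    · intro m hm
      simp only [mem_Ico, mem_Icc] at hm ⊢
      omega
    · intro m hm hm'
      simp only [mem_Ico, mem_Icc] at hm hm'
      simp [Nat.choose_eq_zero_of_lt (show N < m by omega)]
  rw [h_trunc]
  rcases lt_or_ge N ℓ with h | h
  · rw [Ico_eq_empty (by omega), sum_empty, if_neg (by omega)]
  · have h_alt := Int.alternating_sum_range_choose (n := N - ℓ)
    have h_term (k : ℕ) (_ : k ∈ range (N - ℓ + 1)) :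
        (-1 : ℤ) ^ (ℓ + k) * (N.choose (ℓ + k)) * ((ℓ + k).choose ℓ) =
          (-1) ^ ℓ * (N.choose ℓ) * ((-1) ^ k * ((N - ℓ).choose k)) := by
      have h_mul : (N.choose (ℓ + k) * (ℓ + k).choose ℓ : ℤ) =
          N.choose ℓ * (N - ℓ).choose k := by
        norm_cast
        rw [Nat.choose_mul (by omega), Nat.add_sub_cancel_left]
      rw [pow_add]
      linear_combination (-1 : ℤ) ^ ℓ * (-1) ^ k * h_mul
    rw [sum_Ico_eq_sum_range, Nat.sub_add_comm h, sum_congr rfl h_term, ← mul_sum, h_alt]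
    by_cases hNℓ : N = ℓ
    · simp [hNℓ]
    · simp [hNℓ, show N - ℓ ≠ 0 by omega]

/-- The binomial identity from the proof of Proposition 4.2, computing the matrix entries
of the Weyl element `w̃₋₁` on the `j`-dimensional lowest-weight module:
`Σ_{m=ℓ}^{j-1} Σ_{p=0}^{m} (-1)^{m-p} C(m,ℓ) C(j-1-p, m-p) C(q,p)` equals `(-1)^ℓ` if
`q = j-1-ℓ` and `0` otherwise. -/
theorem weyl_binomial_identity (j ℓ q : ℕ) (hj : 1 ≤ j) (hℓ : ℓ ≤ j - 1) (hq : q ≤ j - 1) :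
    (∑ m ∈ Finset.Icc ℓ (j - 1), ∑ p ∈ Finset.range (m + 1),
        (-1 : ℤ) ^ (m - p) * (m.choose ℓ) * ((j - 1 - p).choose (m - p)) * (q.choose p)) =
      if q = j - 1 - ℓ then (-1 : ℤ) ^ ℓ else 0 := by
  have h_inner (m : ℕ) :
      ∑ p ∈ Finset.range (m + 1),
        (-1 : ℤ) ^ (m - p) * (m.choose ℓ) * ((j - 1 - p).choose (m - p)) * (q.choose p) =
      (-1) ^ m * ((j - 1 - q).choose m) * (m.choose ℓ) := by
    rw [← sum_neg_one_pow_mul_choose_sub_mul_choose _ _ _ hq, Finset.sum_mul]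
    exact Finset.sum_congr rfl fun p _ => by ring
  simp only [h_inner]
  rw [sum_Icc_neg_one_pow_mul_choose_mul_choose _ _ _ (Nat.sub_le _ _)]
  exact if_congr (by omega) rfl rfl
end
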